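/- Suppose 0 < α < minᵢ λᵢ. Then f_α is symmetric about α/2 within its domain: for every real t ≥ 0 such that both α/2 + t and α/2 − t lie in [0, minᵢ λᵢ), one has f_α(α/2 + t) = f_α(α/2 − t). -/

import Mathlib

open Matrix

/-- `W(δ) = U · diag(√(λᵢ − δ))`. -/
noncomputable def Wmat {M P : ℕ} (U : Matrix (Fin M) (Fin P) ℝ) (lam : Fin P → ℝ)
    (δ : ℝ) : Matrix (Fin M) (Fin P) ℝ :=
  U * Matrix.diagonal (fun i => Real.sqrt (lam i - δ))

/-- `ẑ(δ) = L⁻¹ · diag(√(λᵢ − δ)) · Uᵀ x`. -/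
noncomputable def zhat {M P : ℕ} (U : Matrix (Fin M) (Fin P) ℝ) (lam : Fin P → ℝ)
    (δ : ℝ) (x : Fin M → ℝ) : Fin P → ℝ :=
  ((Matrix.diagonal lam)⁻¹ * Matrix.diagonal (fun i => Real.sqrt (lam i - δ)) * Uᵀ).mulVec x

/-- Squared Euclidean norm on `ℝ^M`. -/
noncomputable def enormSq {M : ℕ} (v : Fin M → ℝ) : ℝ :=
  ‖(EuclideanSpace.equiv (Fin M) ℝ).symm v‖ ^ 2

/-- `f_α(δ) = (1/2)·(ẑ(δ)ᵀẑ(δ) + (1/α)·‖x − W(δ)ẑ(δ)‖²)`. -/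
noncomputable def fA {M P : ℕ} (U : Matrix (Fin M) (Fin P) ℝ) (lam : Fin P → ℝ)
    (x : Fin M → ℝ) (α δ : ℝ) : ℝ :=
  (1 / 2) * (zhat U lam δ x ⬝ᵥ zhat U lam δ x +
    (1 / α) * enormSq (x - (Wmat U lam δ).mulVec (zhat U lam δ x)))

theorem zhat_apply {M P : ℕ} (U : Matrix (Fin M) (Fin P) ℝ) {lam : Fin P → ℝ}
    (hlam : ∀ i, lam i ≠ 0) (δ : ℝ) (x : Fin M → ℝ) (i : Fin P) :
    zhat U lam δ x i = (lam i)⁻¹ * (Real.sqrt (lam i - δ) * (Uᵀ *ᵥ x) i) := by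
  have hinv : (Matrix.diagonal lam)⁻¹ = Matrix.diagonal (fun i => (lam i)⁻¹) := by
    refine Matrix.inv_eq_right_inv ?_
    rw [Matrix.diagonal_mul_diagonal, ← Matrix.diagonal_one]
    congr 1
    ext i
    exact mul_inv_cancel₀ (hlam i)
  rw [zhat, hinv, ← Matrix.mulVec_mulVec, ← Matrix.mulVec_mulVec, Matrix.mulVec_diagonal,
    Matrix.mulVec_diagonal]

theorem enormSq_eq_dotProduct {M : ℕ} (v : Fin M → ℝ) : enormSq v = v ⬝ᵥ v := by
  rw [enormSq, EuclideanSpace.norm_sq_eq]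
  simp [dotProduct, sq]

theorem enormSq_sub_mulVec {M P : ℕ} {U : Matrix (Fin M) (Fin P) ℝ} (hU : Uᵀ * U = 1)
    (x : Fin M → ℝ) (d : Fin P → ℝ) :
    enormSq (x - U *ᵥ d) = x ⬝ᵥ x - 2 * (Uᵀ *ᵥ x ⬝ᵥ d) + d ⬝ᵥ d := by
  have hcross : x ⬝ᵥ U *ᵥ d = Uᵀ *ᵥ x ⬝ᵥ d := by
    rw [Matrix.dotProduct_mulVec, Matrix.mulVec_transpose]
  have hquad : U *ᵥ d ⬝ᵥ U *ᵥ d = d ⬝ᵥ d := by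
    rw [Matrix.dotProduct_mulVec, ← Matrix.mulVec_transpose, Matrix.mulVec_mulVec, hU,
      Matrix.one_mulVec]
  rw [enormSq_eq_dotProduct, sub_dotProduct, dotProduct_sub, dotProduct_sub, hquad,
    dotProduct_comm (U *ᵥ d) x, hcross]
  ring

/-- `f_α(δ)` depends on `δ` only through `δ² - α δ`. -/
theorem fA_eq_sum {M P : ℕ} {U : Matrix (Fin M) (Fin P) ℝ} (hU : Uᵀ * U = 1)
    {lam : Fin P → ℝ} (hlam : ∀ i, lam i ≠ 0) (x : Fin M → ℝ) {α δ : ℝ} (hα : α ≠ 0)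
    (hδ : ∀ i, δ ≤ lam i) :
    fA U lam x α δ = (1 / 2) * (1 / α * (x ⬝ᵥ x) +
      ∑ i, (Uᵀ *ᵥ x) i ^ 2 *
        (1 / lam i + (δ ^ 2 - α * δ) / (α * lam i ^ 2) - 1 / α)) := by
  rw [fA, Wmat, ← Matrix.mulVec_mulVec, enormSq_sub_mulVec hU, sub_add, mul_sub,
    add_sub_left_comm]
  congr 2
  simp only [dotProduct, Matrix.mulVec_diagonal, zhat_apply U hlam]
  rw [Finset.mul_sum, ← Finset.sum_sub_distrib, Finset.mul_sum, ← Finset.sum_sub_distrib]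
  refine Finset.sum_congr rfl fun i _ => ?_
  have hi := hlam i
  generalize (Uᵀ *ᵥ x) i = c
  have hs : Real.sqrt (lam i - δ) ^ 2 = lam i - δ := Real.sq_sqrt (sub_nonneg.2 (hδ i))
  generalize Real.sqrt (lam i - δ) = s at hs ⊢
  obtain rfl : δ = lam i - s ^ 2 := by linarith
  field_simp
  ring

/-- `f_α` is symmetric about `α/2` within its domain. -/
theorem fA_symmetric_about_half_alpha (M P : ℕ) (hM : 0 < M) (hP : 0 < P)
    (x : Fin M → ℝ)
    (U : Matrix (Fin M) (Fin P) ℝ)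
    (hU : Uᵀ * U = (1 : Matrix (Fin P) (Fin P) ℝ))
    (lam : Fin P → ℝ) (hlam : ∀ i, 0 < lam i)
    (α : ℝ) (hα : 0 < α) (hαlam : ∀ i, α < lam i) :
    ∀ t : ℝ, 0 ≤ t →
      0 ≤ α / 2 + t → (∀ i, α / 2 + t < lam i) →
      0 ≤ α / 2 - t → (∀ i, α / 2 - t < lam i) →
      fA U lam x α (α / 2 + t) = fA U lam x α (α / 2 - t) := by
  intro t _ _ hadd _ hsub
  have hne (i : Fin P) : lam i ≠ 0 := (hlam i).ne'
  rw [fA_eq_sum hU hne x hα.ne' fun i => (hadd i).le,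
    fA_eq_sum hU hne x hα.ne' fun i => (hsub i).le]
  have hsymm : (α / 2 + t) ^ 2 - α * (α / 2 + t) = (α / 2 - t) ^ 2 - α * (α / 2 - t) := by ring
  rw [hsymm]
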